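/- Let β ∈ K with β ≠ 0 be such that the plane sextic C : X⁶ + Y⁶ + Z⁶ + βX²Y²Z² = 0 is smooth. Then Aut(C) ⊂ PGL₃(K) equals the subgroup generated by diag(1, ζ₆, ζ₆²), diag(1, 1, −1), [Z:Y:X], and [Y:Z:X]; it has order 72 and is isomorphic to a semidirect product Z/3Z ⋊ S₄ (the group GAP(72,43)), where S₄ is the symmetric group on four letters. -/

import Mathlib

open MvPolynomial

/-- `GL₃(K)`: the group of invertible `3 × 3` matrices over `K`. -/
abbrev GL3 (K : Type*) [Field K] := (Matrix (Fin 3) (Fin 3) K)ˣ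

/-- `PGL₃(K)`: the quotient of `GL₃(K)` by its center (the scalar matrices). -/
abbrev PGL3 (K : Type*) [Field K] := GL3 K ⧸ Subgroup.center (GL3 K)

variable {K : Type*} [Field K]

/-- The substitution `F(X,Y,Z) ↦ F(A·(X,Y,Z)ᵗ)` for a `3 × 3` matrix `A`. -/
noncomputable def matAct (A : Matrix (Fin 3) (Fin 3) K) (F : MvPolynomial (Fin 3) K) :
    MvPolynomial (Fin 3) K :=
  aeval (fun i => ∑ j, C (A i j) * X j) F

lemma matAct_one (F : MvPolynomial (Fin 3) K) : matAct 1 F = F := by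
  unfold matAct
  have h : (fun i => ∑ j, C ((1 : Matrix (Fin 3) (Fin 3) K) i j) * X j)
      = (X : Fin 3 → MvPolynomial (Fin 3) K) := by
    funext i
    rw [Finset.sum_eq_single i]
    · simp
    · intro b _ hb
      simp [Matrix.one_apply, Ne.symm hb]
    · simp
  rw [h, aeval_X_left_apply]

lemma matAct_matAct (A B : Matrix (Fin 3) (Fin 3) K) (F : MvPolynomial (Fin 3) K) :
    matAct B (matAct A F) = matAct (A * B) F := by
  unfold matAct
  rw [← AlgHom.comp_apply, comp_aeval]
  have h : (fun i => (aeval fun i => ∑ j, C (B i j) * X j) (∑ j, C (A i j) * X j))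
      = fun i => ∑ j : Fin 3, C ((A * B) i j) * (X j : MvPolynomial (Fin 3) K) := by
    funext i
    simp only [map_sum, map_mul, aeval_C, aeval_X, algebraMap_eq, Finset.mul_sum]
    rw [Finset.sum_comm]
    refine Finset.sum_congr rfl fun k _ => ?_
    rw [Matrix.mul_apply, map_sum, Finset.sum_mul]
    refine Finset.sum_congr rfl fun j _ => ?_
    rw [map_mul, mul_assoc]
  rw [h]

lemma matAct_smul (A : Matrix (Fin 3) (Fin 3) K) (c : K) (F : MvPolynomial (Fin 3) K) :
    matAct A (c • F) = c • matAct A F :=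
  map_smul (aeval fun i => ∑ j, C (A i j) * X j) c F

/-- The class of a matrix `A` in `PGL₃(K)` (junk value `1` if `A` is not invertible). -/
noncomputable def pgl (A : Matrix (Fin 3) (Fin 3) K) : PGL3 K := by
  classical
  exact if h : IsUnit A then (QuotientGroup.mk h.unit : PGL3 K) else 1

/-- `F` defines a smooth plane sextic: `F` is homogeneous of degree `6`, and `F` together with
its partial derivatives have no common zero besides the origin. -/
def IsSmoothSextic (F : MvPolynomial (Fin 3) K) : Prop :=
  F.IsHomogeneous 6 ∧
    ∀ p : Fin 3 → K, eval p F = 0 → (∀ i, eval p (pderiv i F) = 0) → p = 0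

/-- The automorphism group of the plane curve `F = 0`: the subgroup of `PGL₃(K)` consisting of
the classes of matrices `A ∈ GL₃(K)` with `F(A·(X,Y,Z)ᵗ) = λ·F(X,Y,Z)` for some `λ ∈ K×`. -/
noncomputable def planeAut (F : MvPolynomial (Fin 3) K) : Subgroup (PGL3 K) where
  carrier := {g | ∃ A : GL3 K, (QuotientGroup.mk A : PGL3 K) = g ∧
    ∃ c : K, c ≠ 0 ∧ matAct (A : Matrix (Fin 3) (Fin 3) K) F = c • F}
  one_mem' := ⟨1, rfl, 1, one_ne_zero, by rw [Units.val_one, matAct_one, one_smul]⟩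
  mul_mem' := by
    rintro g h ⟨A, rfl, c, hc, hA⟩ ⟨B, rfl, d, hd, hB⟩
    exact ⟨A * B, rfl, c * d, mul_ne_zero hc hd, by
      rw [Units.val_mul, ← matAct_matAct, hA, matAct_smul, hB, smul_smul]⟩
  inv_mem' := by
    rintro g ⟨A, rfl, c, hc, hA⟩
    refine ⟨A⁻¹, rfl, c⁻¹, inv_ne_zero hc, ?_⟩
    rw [eq_inv_smul_iff₀ hc, ← matAct_smul, ← hA, matAct_matAct, ← Units.val_mul,
      mul_inv_cancel, Units.val_one, matAct_one]

/-- The plane sextic `X⁶ + Y⁶ + Z⁶ + βX²Y²Z²`. -/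
noncomputable abbrev fermatDescendant (β : K) : MvPolynomial (Fin 3) K :=
  X 0 ^ 6 + X 1 ^ 6 + X 2 ^ 6 + C β * X 0 ^ 2 * X 1 ^ 2 * X 2 ^ 2

section MonomialMatrices

lemma eval_matAct (A : Matrix (Fin 3) (Fin 3) K) (p : MvPolynomial (Fin 3) K) (x : Fin 3 → K) :
    eval x (matAct A p) = eval (A.mulVec x) p := by
  unfold matAct
  rw [aeval_def, algebraMap_eq, eval_eval₂]
  have h : (eval x).comp C = RingHom.id K := by ext; simp
  rw [h, MvPolynomial.eval₂_id]
  congr 2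
  funext i
  simp [Matrix.mulVec, dotProduct]

lemma pderiv_matAct (A : Matrix (Fin 3) (Fin 3) K) (p : MvPolynomial (Fin 3) K) (i : Fin 3) :
    pderiv i (matAct A p) = ∑ k, C (A k i) * matAct A (pderiv k p) := by
  unfold matAct
  induction p using MvPolynomial.induction_on with
  | C a => simp
  | add p q hp hq => simp only [map_add, hp, hq, mul_add, Finset.sum_add_distrib]
  | mul_X p n hp =>
    have h : pderiv i (∑ j, C (A n j) * X j : MvPolynomial (Fin 3) K) = C (A n i) := by
      simp [pderiv_X, Pi.single_apply]
    have h' : ∀ k, aeval (fun i => ∑ j, C (A i j) * X j) (pderiv k (X n : MvPolynomial (Fin 3) K))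
        = if k = n then 1 else 0 := by
      intro k
      by_cases hk : k = n
      · subst hk; simp
      · simp [pderiv_X_of_ne (Ne.symm hk), hk]
    rw [map_mul, aeval_X, Derivation.leibniz, h, hp]
    simp only [Derivation.leibniz, map_add, smul_eq_mul, map_mul, h', aeval_X, mul_ite, mul_one,
      mul_zero, mul_add, Finset.sum_add_distrib, Finset.sum_ite_eq', Finset.mem_univ, if_true]
    congr 1
    · ring
    · rw [Finset.mul_sum]
      exact Finset.sum_congr rfl fun _ _ => by ring

lemma pderiv_pderiv_matAct (A : Matrix (Fin 3) (Fin 3) K) (p : MvPolynomial (Fin 3) K)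
    (i j : Fin 3) :
    pderiv i (pderiv j (matAct A p))
      = ∑ l, ∑ k, C (A l j * A k i) * matAct A (pderiv k (pderiv l p)) := by
  rw [pderiv_matAct, map_sum]
  refine Finset.sum_congr rfl fun l _ => ?_
  rw [Derivation.leibniz, pderiv_matAct]
  simp [Finset.mul_sum, mul_assoc]

lemma pderiv_fermatDescendant (β : K) (l : Fin 3) :
    pderiv l (fermatDescendant β)
      = C 6 * X l ^ 5 + C (2 * β) * (X l * X (l + 1) ^ 2 * X (l + 2) ^ 2) := by
  have h6 : (C 6 : MvPolynomial (Fin 3) K) = 6 := map_ofNat C 6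
  have h2 : (C 2 : MvPolynomial (Fin 3) K) = 2 := map_ofNat C 2
  fin_cases l <;>
  · simp [pderiv_X, Derivation.leibniz, Derivation.leibniz_pow, h6, h2]
    ring

lemma pderiv_pderiv_self_fermatDescendant (β : K) (l : Fin 3) :
    pderiv l (pderiv l (fermatDescendant β))
      = C 30 * X l ^ 4 + C (2 * β) * (X (l + 1) ^ 2 * X (l + 2) ^ 2) := by
  have h6 : (C 6 : MvPolynomial (Fin 3) K) = 6 := map_ofNat C 6
  have h30 : (C 30 : MvPolynomial (Fin 3) K) = 30 := map_ofNat C 30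
  rw [pderiv_fermatDescendant]
  simp only [map_add, pderiv_C_mul]
  fin_cases l <;>
  · simp [pderiv_X, Derivation.leibniz, Derivation.leibniz_pow, h6, h30]
    ring

lemma pderiv_pderiv_of_ne_fermatDescendant (β : K) {k l m : Fin 3} (hkl : k ≠ l) (hkm : k ≠ m)
    (hlm : l ≠ m) :
    pderiv k (pderiv l (fermatDescendant β)) = C (4 * β) * (X 0 * X 1 * X 2 * X m) := by
  have h4 : (C 4 : MvPolynomial (Fin 3) K) = 4 := map_ofNat C 4
  have h2 : (C 2 : MvPolynomial (Fin 3) K) = 2 := map_ofNat C 2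
  rw [pderiv_fermatDescendant]
  simp only [map_add, pderiv_C_mul]
  fin_cases k <;> fin_cases l <;> fin_cases m <;>
    first
    | exact absurd rfl hkl
    | exact absurd rfl hkm
    | exact absurd rfl hlm
    | (simp [pderiv_X, Derivation.leibniz, Derivation.leibniz_pow, h2, h4]
       ring)

/-- The second partial derivatives of `X⁶ + Y⁶ + Z⁶ + βX²Y²Z²` have no term `Xᵢ³Xⱼ`, `i ≠ j`. -/
lemma eval_pderiv_hessian (β : K) {i j : Fin 3} (hij : i ≠ j) (k l : Fin 3) :
    eval (Pi.single i 1) (pderiv j (pderiv k (pderiv l (fermatDescendant β)))) = 0 := by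
  by_cases hkl : k = l
  · subst hkl
    rw [pderiv_pderiv_self_fermatDescendant]
    simp only [map_add, Derivation.leibniz, Derivation.leibniz_pow, pderiv_X]
    fin_cases i <;> fin_cases j <;> first | exact absurd rfl hij | skip
    all_goals fin_cases k <;> simp
  · obtain ⟨m, hkm, hlm⟩ : ∃ m, k ≠ m ∧ l ≠ m := by
      revert k l; decide
    rw [pderiv_pderiv_of_ne_fermatDescendant β hkl hkm hlm]
    simp only [Derivation.leibniz, pderiv_X]
    fin_cases i <;> fin_cases j <;> first | exact absurd rfl hij | skip
    all_goals fin_cases m <;> simp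

lemma eval_pderiv_matAct_hessian {β c : K} (A : GL3 K)
    (hA : matAct A.val (fermatDescendant β) = c • fermatDescendant β) {i j : Fin 3} (hij : i ≠ j)
    (k l : Fin 3) :
    eval (Pi.single i 1)
      (pderiv j (matAct A.val (pderiv k (pderiv l (fermatDescendant β))))) = 0 := by
  set H : Matrix (Fin 3) (Fin 3) K := Matrix.of fun k l => eval (Pi.single i 1)
    (pderiv j (matAct A.val (pderiv k (pderiv l (fermatDescendant β))))) with hH
  have key : A.val.transpose * H * A.val = 0 := by
    ext a b
    have h := congrArg (fun p => eval (Pi.single i 1 : Fin 3 → K) (pderiv j p))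
      (pderiv_pderiv_matAct A.val (fermatDescendant β) a b)
    simp only [hA, Derivation.map_smul, smul_eval, eval_pderiv_hessian β hij, mul_zero, map_sum] at h
    rw [Matrix.zero_apply, h, Matrix.mul_apply]
    refine Finset.sum_congr rfl fun l _ => ?_
    rw [Matrix.mul_apply, Finset.sum_mul]
    refine Finset.sum_congr rfl fun k _ => ?_
    simp [hH, Derivation.leibniz]
    ring
  have h0 : H = 0 := by
    have hT : IsUnit A.val.transpose := (Matrix.isUnit_transpose A.val).2 A.isUnit
    rw [A.isUnit.mul_left_eq_zero, hT.mul_right_eq_zero] at key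
    exact key
  exact congrFun (congrFun h0 k) l

lemma product_rows_relations [CharZero K] {β c : K} (hβ : β ≠ 0) (A : GL3 K)
    (hA : matAct A.val (fermatDescendant β) = c • fermatDescendant β) {i j : Fin 3} (hij : i ≠ j)
    (r : Fin 3) :
    (A.val 0 i * A.val 1 i * A.val 2 j + A.val 0 i * A.val 1 j * A.val 2 i
        + A.val 0 j * A.val 1 i * A.val 2 i) * A.val r i
      + A.val 0 i * A.val 1 i * A.val 2 i * A.val r j = 0 := by
  have hX : ∀ n : Fin 3, eval (Pi.single i 1 : Fin 3 → K) (matAct A.val (X n)) = A.val n i := by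
    intro n
    simp [eval_matAct]
  have hD : ∀ n : Fin 3, eval (Pi.single i 1 : Fin 3 → K) (pderiv j (matAct A.val (X n)))
      = A.val n j := by
    intro n
    rw [pderiv_matAct]
    simp [eval_matAct, pderiv_X, Pi.single_apply, apply_ite, Finset.sum_ite_eq]
  have h4 : (4 * β) ≠ 0 := mul_ne_zero (by norm_num) hβ
  have key : ∃ k l : Fin 3, pderiv k (pderiv l (fermatDescendant β))
      = C (4 * β) * (X 0 * X 1 * X 2 * X r) := by
    obtain ⟨k, l, hkl, hkr, hlr⟩ : ∃ k l : Fin 3, k ≠ l ∧ k ≠ r ∧ l ≠ r := by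
      revert r; decide
    exact ⟨k, l, pderiv_pderiv_of_ne_fermatDescendant β hkl hkr hlr⟩
  obtain ⟨k, l, hkl⟩ := key
  have h := eval_pderiv_matAct_hessian A hA hij k l
  have hm : ∀ p q : MvPolynomial (Fin 3) K, matAct A.val (p * q) = matAct A.val p * matAct A.val q :=
    fun p q => map_mul _ p q
  have hC : ∀ a : K, matAct A.val (C a) = C a := fun a => by simp [matAct]
  rw [hkl] at h
  simp only [hm, hC, Derivation.leibniz, smul_eq_mul, map_add, map_mul, hX, hD, eval_C, pderiv_C,
    mul_zero, add_zero] at h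
  refine (mul_eq_zero.1 (Eq.trans ?_ h)).resolve_left h4
  ring

lemma column_relations [CharZero K] {β c : K} (hβ : β ≠ 0) (A : GL3 K)
    (hA : matAct A.val (fermatDescendant β) = c • fermatDescendant β) {i j : Fin 3} (hij : i ≠ j) :
    A.val 0 i * A.val 1 i * A.val 2 j + A.val 0 i * A.val 1 j * A.val 2 i
        + A.val 0 j * A.val 1 i * A.val 2 i = 0 ∧
      A.val 0 i * A.val 1 i * A.val 2 i = 0 := by
  set a := A.val 0 i * A.val 1 i * A.val 2 j + A.val 0 i * A.val 1 j * A.val 2 i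
        + A.val 0 j * A.val 1 i * A.val 2 i
  set b := A.val 0 i * A.val 1 i * A.val 2 i
  have h : A.val.mulVec (Pi.single i a + Pi.single j b) = 0 := by
    funext r
    have := product_rows_relations hβ A hA hij r
    simp only [Matrix.mulVec_add, Pi.add_apply, Matrix.mulVec_single, Pi.zero_apply]
    simpa [mul_comm] using this
  have h0 := Matrix.mulVec_injective_of_isUnit A.isUnit (h.trans (Matrix.mulVec_zero _).symm)
  have hi := congrFun h0 i
  have hj := congrFun h0 j
  simp [hij, hij.symm] at hi hj
  exact ⟨hi, hj⟩

lemma exists_row_ne_zero (A : GL3 K) (r : Fin 3) : ∃ j, A.val r j ≠ 0 := by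
  by_contra! h
  have h1 : (A.val * (A⁻¹).val) r r = 1 := by
    rw [← Units.val_mul, mul_inv_cancel]; simp
  simp [Matrix.mul_apply, h] at h1

lemma exists_column_ne_zero (A : GL3 K) (i : Fin 3) : ∃ r, A.val r i ≠ 0 := by
  by_contra! h
  have h1 : ((A⁻¹).val * A.val) i i = 1 := by
    rw [← Units.val_mul, inv_mul_cancel]; simp
  simp [Matrix.mul_apply, h] at h1

lemma exists_column_support [CharZero K] {β c : K} (hβ : β ≠ 0) (A : GL3 K)
    (hA : matAct A.val (fermatDescendant β) = c • fermatDescendant β) (i : Fin 3) :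
    ∃ r, A.val r i ≠ 0 ∧ ∀ s, s ≠ r → A.val s i = 0 := by
  obtain ⟨t, ht⟩ := exists_column_ne_zero A i
  have h0 : A.val 0 i * A.val 1 i * A.val 2 i = 0 :=
    (column_relations hβ A hA (j := i + 1) (by fin_cases i <;> decide)).2
  have h1 : ∀ j, i ≠ j → A.val 0 i * A.val 1 i * A.val 2 j + A.val 0 i * A.val 1 j * A.val 2 i
        + A.val 0 j * A.val 1 i * A.val 2 i = 0 := fun j hj => (column_relations hβ A hA hj).1
  have hrow : ∀ r, A.val r i = 0 → ∃ j, i ≠ j ∧ A.val r j ≠ 0 := by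
    intro r hr
    obtain ⟨j, hj⟩ := exists_row_ne_zero A r
    exact ⟨j, fun h => hj (h ▸ hr), hj⟩
  have p01 : A.val 0 i * A.val 1 i = 0 := by
    by_contra h
    have hz : A.val 2 i = 0 := (mul_eq_zero.1 h0).resolve_left h
    obtain ⟨j, hij, hj⟩ := hrow 2 hz
    have := h1 j hij
    simp [hz, hj] at this
    simp [this] at h
  have p02 : A.val 0 i * A.val 2 i = 0 := by
    by_contra h
    have hz : A.val 1 i = 0 := by
      by_contra h'
      exact mul_ne_zero h h' (by linear_combination h0)
    obtain ⟨j, hij, hj⟩ := hrow 1 hz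
    have := h1 j hij
    simp [hz, hj] at this
    simp [this] at h
  have p12 : A.val 1 i * A.val 2 i = 0 := by
    by_contra h
    have hz : A.val 0 i = 0 := by
      by_contra h'
      exact mul_ne_zero h h' (by linear_combination h0)
    obtain ⟨j, hij, hj⟩ := hrow 0 hz
    have := h1 j hij
    simp [hz, hj] at this
    simp [this] at h
  refine ⟨t, ht, fun s hs => ?_⟩
  fin_cases t <;> fin_cases s <;> simp_all

/-- A linear automorphism of the sextic is a monomial matrix. -/
lemma exists_perm_of_matAct [CharZero K] {β c : K} (hβ : β ≠ 0) (A : GL3 K)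
    (hA : matAct A.val (fermatDescendant β) = c • fermatDescendant β) :
    ∃ (σ : Equiv.Perm (Fin 3)) (b : Fin 3 → K), (∀ r, b r ≠ 0) ∧
      ∀ x r, A.val.mulVec x r = b r * x (σ r) := by
  choose f hf hf0 using exists_column_support hβ A hA
  have hsurj : Function.Surjective f := by
    intro r
    obtain ⟨j, hj⟩ := exists_row_ne_zero A r
    exact ⟨j, by_contra fun h => hj (hf0 j r (Ne.symm h))⟩
  have hbij : Function.Bijective f := ⟨Finite.injective_iff_surjective.2 hsurj, hsurj⟩
  set σ := (Equiv.ofBijective f hbij).symm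
  have hσ : ∀ r, f (σ r) = r := fun r => (Equiv.ofBijective f hbij).apply_symm_apply r
  refine ⟨σ, fun r => A.val r (σ r), fun r => ?_, fun x r => ?_⟩
  · have := hf (σ r)
    rwa [hσ] at this
  · rw [Matrix.mulVec, dotProduct, Finset.sum_eq_single (σ r)]
    · intro j _ hj
      rw [hf0 j r, zero_mul]
      intro h
      exact hj (hbij.1 (by rw [hσ, h]))
    · simp

lemma monomial_coefficients {β c : K} (hβ : β ≠ 0) (A : Matrix (Fin 3) (Fin 3) K)
    (hA : matAct A (fermatDescendant β) = c • fermatDescendant β)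
    (σ : Equiv.Perm (Fin 3)) (b : Fin 3 → K) (hb : ∀ x r, A.mulVec x r = b r * x (σ r)) :
    (∀ r, b r ^ 6 = c) ∧ (b 0 * b 1 * b 2) ^ 2 = c := by
  have he : ∀ x : Fin 3 → K, (∑ r, (b r * x (σ r)) ^ 6) + β * (∏ r, b r * x (σ r)) ^ 2
      = c * ((∑ r, x r ^ 6) + β * (∏ r, x r) ^ 2) := by
    intro x
    have h := congrArg (eval x) hA
    rw [eval_matAct, smul_eval] at h
    simp only [map_add, map_mul, map_pow, eval_X, eval_C, hb] at h
    simp only [Fin.sum_univ_three, Fin.prod_univ_three]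
    linear_combination h
  have h6 : ∀ r, b r ^ 6 = c := by
    intro r
    have h := he (Pi.single (σ r) 1)
    have hz : ∀ s, (∏ t, (Pi.single s 1 : Fin 3 → K) t) = 0 := by
      intro s
      refine Finset.prod_eq_zero (i := s + 1) (Finset.mem_univ _) ?_
      fin_cases s <;> simp
    rw [Finset.prod_mul_distrib, Equiv.prod_comp σ (Pi.single (σ r) 1 : Fin 3 → K), hz] at h
    simpa [Pi.single_apply, mul_pow, ite_pow] using h
  refine ⟨h6, ?_⟩
  have h := he 1
  simp only [Pi.one_apply, mul_one, h6, Finset.prod_const_one, Finset.sum_const, Fin.prod_univ_three,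
    one_pow] at h
  apply mul_left_cancel₀ hβ
  simp at h
  linear_combination h

end MonomialMatrices

section TetrahedralRepresentation

/-- The vertices of a regular tetrahedron, as sign vectors with product `1`. -/
def tetraVertex (K : Type*) [Field K] (i : Fin 4) : Fin 3 → K :=
  ![![1, 1, 1], ![1, -1, -1], ![-1, 1, -1], ![-1, -1, 1]] i

lemma exists_tetraVertex_eq (s : Fin 3 → K) (hs : ∀ r, s r = 1 ∨ s r = -1)
    (hp : s 0 * s 1 * s 2 = 1) : ∃ j, s = tetraVertex K j := by
  have h01 : s 2 = s 0 * s 1 := by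
    rcases hs 2 with h | h <;> rw [h] at hp ⊢
    · linear_combination -hp
    · linear_combination hp
  rcases hs 0 with h0 | h0 <;> rcases hs 1 with h1 | h1
  · exact ⟨0, by ext r; fin_cases r <;> simp [tetraVertex, h0, h1, h01]⟩
  · exact ⟨1, by ext r; fin_cases r <;> simp [tetraVertex, h0, h1, h01]⟩
  · exact ⟨2, by ext r; fin_cases r <;> simp [tetraVertex, h0, h1, h01]⟩
  · exact ⟨3, by ext r; fin_cases r <;> simp [tetraVertex, h0, h1, h01]⟩

lemma tetraVertex_eq_one_or (j : Fin 4) (r : Fin 3) :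
    tetraVertex K j r = 1 ∨ tetraVertex K j r = -1 := by
  fin_cases j <;> fin_cases r <;> simp [tetraVertex]

lemma tetraVertex_prod (j : Fin 4) :
    tetraVertex K j 0 * tetraVertex K j 1 * tetraVertex K j 2 = 1 := by
  fin_cases j <;> simp [tetraVertex]

variable [CharZero K]

lemma tetraVertex_injective : Function.Injective (tetraVertex K) := by
  have h : (1 : K) ≠ -1 := fun h => two_ne_zero (α := K) (by linear_combination h)
  intro i j hij
  have h0 := congrFun hij 0
  have h1 := congrFun hij 1
  fin_cases i <;> fin_cases j <;> first | rfl | simp_all [tetraVertex, eq_comm]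

/-- The matrix permuting the vertices of the tetrahedron according to `σ`. -/
noncomputable def tetraMatrix (K : Type*) [Field K] (σ : Fin 4 → Fin 4) :
    Matrix (Fin 3) (Fin 3) K :=
  Matrix.of fun a b => (1 / 4) * ∑ i, tetraVertex K (σ i) a * tetraVertex K i b

lemma tetraMatrix_mulVec (σ : Equiv.Perm (Fin 4)) (j : Fin 4) :
    (tetraMatrix K σ).mulVec (tetraVertex K j) = tetraVertex K (σ j) := by
  have hdot : ∀ i, ∑ b, tetraVertex K i b * tetraVertex K j b = if i = j then 3 else -1 := by
    intro i
    fin_cases i <;> fin_cases j <;> simp [tetraVertex, Fin.sum_univ_three] <;> norm_num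
  have hsum : ∀ a, ∑ i, tetraVertex K (σ i) a = 0 := by
    intro a
    rw [Equiv.sum_comp σ (fun i => tetraVertex K i a)]
    fin_cases a <;> simp [tetraVertex, Fin.sum_univ_four]
  funext a
  have h : (tetraMatrix K σ).mulVec (tetraVertex K j) a
      = (1 / 4) * ∑ i, tetraVertex K (σ i) a * ∑ b, tetraVertex K i b * tetraVertex K j b := by
    simp only [tetraMatrix, Matrix.mulVec, dotProduct, Matrix.of_apply, Finset.mul_sum,
      Finset.sum_mul]
    rw [Finset.sum_comm]
    exact Finset.sum_congr rfl fun _ _ => Finset.sum_congr rfl fun _ _ => by ring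
  have h' : ∑ i, tetraVertex K (σ i) a * (if i = j then 3 else -1)
      = 4 * tetraVertex K (σ j) a - ∑ i, tetraVertex K (σ i) a := by
    have : ∀ i, tetraVertex K (σ i) a * (if i = j then 3 else -1)
        = (if i = j then 4 * tetraVertex K (σ i) a else 0) - tetraVertex K (σ i) a := by
      intro i; split_ifs <;> ring
    simp only [this, Finset.sum_sub_distrib, Finset.sum_ite_eq', Finset.mem_univ, if_true]
  simp only [h, hdot, h', hsum]
  ring

lemma matrix_ext_of_tetraVertex {M N : Matrix (Fin 3) (Fin 3) K}
    (h : ∀ j, M.mulVec (tetraVertex K j) = N.mulVec (tetraVertex K j)) : M = N := by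
  have h2 : (2 : K) ≠ 0 := two_ne_zero
  ext a b
  have h0 := congrFun (h 0) a
  have h1 := congrFun (h 1) a
  have h3 := congrFun (h 2) a
  have h4 := congrFun (h 3) a
  simp only [Matrix.mulVec, dotProduct, tetraVertex, Fin.sum_univ_three] at h0 h1 h3 h4
  simp at h0 h1 h3 h4
  apply mul_left_cancel₀ h2
  obtain rfl | rfl | rfl : b = 0 ∨ b = 1 ∨ b = 2 := by revert b; decide
  · linear_combination h0 + h1
  · linear_combination h0 + h3
  · linear_combination h0 + h4

/-- The representation of `S₄` as the symmetry group of the tetrahedron. -/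
noncomputable def tetraRep (K : Type*) [Field K] [CharZero K] :
    Equiv.Perm (Fin 4) →* Matrix (Fin 3) (Fin 3) K where
  toFun σ := tetraMatrix K σ
  map_one' := matrix_ext_of_tetraVertex fun j => by rw [tetraMatrix_mulVec]; simp
  map_mul' σ τ := matrix_ext_of_tetraVertex fun j => by
    rw [← Matrix.mulVec_mulVec]
    simp only [tetraMatrix_mulVec, Equiv.Perm.mul_apply]

lemma tetraRep_mulVec (σ : Equiv.Perm (Fin 4)) (j : Fin 4) :
    (tetraRep K σ).mulVec (tetraVertex K j) = tetraVertex K (σ j) :=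
  tetraMatrix_mulVec σ j

end TetrahedralRepresentation

section SemidirectProduct

/-- The diagonal matrices `diag(1, ωᵗ, ω²ᵗ)` for a cube root of unity `ω`. -/
def diagRep (ω : K) (hω : ω ^ 3 = 1) : Multiplicative (ZMod 3) →* Matrix (Fin 3) (Fin 3) K where
  toFun t := Matrix.diagonal fun r => (ω ^ (Multiplicative.toAdd t).val) ^ (r : ℕ)
  map_one' := by
    ext i j
    by_cases h : i = j <;> simp [h, Matrix.one_apply]
  map_mul' s t := by
    rw [Matrix.diagonal_mul_diagonal]
    congr 1
    funext r
    rw [← mul_pow, ← pow_add, toAdd_mul, ZMod.val_add, ← pow_eq_pow_mod _ hω]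

/-- The action of `±1` on a commutative group by `t ↦ t^{±1}`. -/
def signAut (M : Type*) [CommGroup M] : ℤˣ →* MulAut M where
  toFun u :=
    { toFun := fun t => t ^ (u : ℤ)
      invFun := fun t => t ^ (u : ℤ)
      left_inv := fun t => by
        simp only [← zpow_mul, Int.units_coe_mul_self, zpow_one]
      right_inv := fun t => by
        simp only [← zpow_mul, Int.units_coe_mul_self, zpow_one]
      map_mul' := fun s t => mul_zpow s t _ }
  map_one' := by ext; simp
  map_mul' u v := by
    ext t
    simp only [Units.val_mul, MulEquiv.coe_mk, Equiv.coe_fn_mk, MulAut.mul_apply, zpow_mul']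

variable [CharZero K]

lemma tetraRep_eq {M : Matrix (Fin 3) (Fin 3) K} {σ : Equiv.Perm (Fin 4)}
    (h : ∀ j, M.mulVec (tetraVertex K j) = tetraVertex K (σ j)) : tetraRep K σ = M :=
  matrix_ext_of_tetraVertex fun j => by rw [tetraRep_mulVec, h]

lemma tetraRep_swap_conj (x : K) (hx : x ^ 3 = 1) (i : Fin 3) :
    ∃ c : K, Matrix.diagonal (fun r : Fin 3 => x ^ (r : ℕ))
        * tetraRep K (Equiv.swap i.castSucc i.succ) * Matrix.diagonal (fun r : Fin 3 => x ^ (r : ℕ))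
      = c • tetraRep K (Equiv.swap i.castSucc i.succ) := by
  have h01 : tetraRep K (Equiv.swap (Fin.castSucc 0) (Fin.succ 0))
      = !![1, 0, 0; 0, 0, -1; 0, -1, 0] :=
    tetraRep_eq fun j => by
      ext r; fin_cases j <;> fin_cases r <;> simp [tetraVertex, Equiv.swap_apply_def]
  have h12 : tetraRep K (Equiv.swap (Fin.castSucc 1) (Fin.succ 1))
      = !![0, 1, 0; 1, 0, 0; 0, 0, 1] :=
    tetraRep_eq fun j => by
      ext r; fin_cases j <;> fin_cases r <;> simp [tetraVertex, Equiv.swap_apply_def]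
  have h23 : tetraRep K (Equiv.swap (Fin.castSucc 2) (Fin.succ 2))
      = !![1, 0, 0; 0, 0, 1; 0, 1, 0] :=
    tetraRep_eq fun j => by
      ext r; fin_cases j <;> fin_cases r <;> simp [tetraVertex, Equiv.swap_apply_def]
  have hx' : x * x ^ 2 = 1 := by linear_combination hx
  have hx'' : x ^ 2 * x = 1 := by linear_combination hx
  have hx4 : x ^ 2 * x ^ 2 = x := by linear_combination x * hx
  obtain rfl | rfl | rfl : i = 0 ∨ i = 1 ∨ i = 2 := by revert i; decide
  · refine ⟨1, ?_⟩
    rw [h01]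
    ext a b
    fin_cases a <;> fin_cases b <;> simp [Matrix.mul_apply, Matrix.diagonal_apply, hx', hx'']
  · refine ⟨x, ?_⟩
    rw [h12]
    ext a b
    fin_cases a <;> fin_cases b <;> simp [Matrix.mul_apply, Matrix.diagonal_apply, hx4]
  · refine ⟨1, ?_⟩
    rw [h23]
    ext a b
    fin_cases a <;> fin_cases b <;> simp [Matrix.mul_apply, Matrix.diagonal_apply, hx', hx'']

lemma pgl3_mk_eq_mk_iff {F : Type*} [Field F] (A B : GL3 F) :
    (QuotientGroup.mk A : PGL3 F) = QuotientGroup.mk B ↔ ∃ c : F, A.val = c • B.val := by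
  rw [eq_comm, QuotientGroup.eq]
  refine (Matrix.GeneralLinearGroup.mem_center_iff_val_mem_range_scalar (g := B⁻¹ * A)).trans ?_
  constructor
  · rintro ⟨c, hc⟩
    refine ⟨c, ?_⟩
    have h : A.val = B.val * (B⁻¹ * A).val := by rw [← Units.val_mul, mul_inv_cancel_left]
    rw [h, ← hc]
    simp [Matrix.scalar_apply, ← Matrix.smul_one_eq_diagonal]
  · rintro ⟨c, hc⟩
    refine ⟨c, ?_⟩
    rw [Units.val_mul, hc, Matrix.mul_smul, ← Units.val_mul, inv_mul_cancel]
    simp [Matrix.scalar_apply, ← Matrix.smul_one_eq_diagonal]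

lemma pgl_eq_mk {F : Type*} [Field F] {M : Matrix (Fin 3) (Fin 3) F} {A : GL3 F} {c : F}
    (hc : c ≠ 0) (h : M = c • A.val) : pgl M = QuotientGroup.mk A := by
  have hM : IsUnit M := by
    rw [h]
    exact (Units.mk0 c hc • A).isUnit
  rw [pgl, dif_pos hM, pgl3_mk_eq_mk_iff]
  exact ⟨c, h⟩

/-- The diagonal representation of `Z/3Z`, projectivized. -/
def diagProj (ω : K) (hω : ω ^ 3 = 1) : Multiplicative (ZMod 3) →* PGL3 K :=
  (QuotientGroup.mk' _).comp (diagRep ω hω).toHomUnits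

/-- The tetrahedral representation of `S₄`, projectivized. -/
noncomputable def tetraProj (K : Type*) [Field K] [CharZero K] : Equiv.Perm (Fin 4) →* PGL3 K :=
  (QuotientGroup.mk' _).comp (tetraRep K).toHomUnits

/-- `S₄` acting on `Z/3Z` through the sign. -/
def signAction : Equiv.Perm (Fin 4) →* MulAut (Multiplicative (ZMod 3)) :=
  (signAut _).comp Equiv.Perm.sign

lemma perm_fin_four_induction {p : Equiv.Perm (Fin 4) → Prop} (one : p 1)
    (swap : ∀ i : Fin 3, p (Equiv.swap i.castSucc i.succ))
    (mul : ∀ σ τ, p σ → p τ → p (σ * τ)) (σ : Equiv.Perm (Fin 4)) : p σ := by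
  have h : σ ∈ Submonoid.closure
      (Set.range fun i : Fin 3 => Equiv.swap i.castSucc i.succ) := by
    rw [Equiv.Perm.mclosure_swap_castSucc_succ]; trivial
  induction h using Submonoid.closure_induction with
  | mem x hx => obtain ⟨i, rfl⟩ := hx; exact swap i
  | one => exact one
  | mul x y _ _ hx hy => exact mul x y hx hy

lemma diagProj_signAction (ω : K) (hω : ω ^ 3 = 1) (σ : Equiv.Perm (Fin 4)) :
    (diagProj ω hω).comp (signAction σ).toMonoidHom
      = (MulAut.conj (tetraProj K σ)).toMonoidHom.comp (diagProj ω hω) := by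
  induction σ using perm_fin_four_induction with
  | one => ext; simp
  | swap i =>
    refine MonoidHom.ext fun t => ?_
    have hs : signAction (Equiv.swap i.castSucc i.succ) t = t⁻¹ := by
      have h : Equiv.Perm.sign (Equiv.swap i.castSucc i.succ) = -1 :=
        Equiv.Perm.sign_swap (by revert i; decide)
      simp [signAction, h, signAut]
    have h : diagProj ω hω t * tetraProj K (Equiv.swap i.castSucc i.succ) * diagProj ω hω t
        = tetraProj K (Equiv.swap i.castSucc i.succ) :=
      (pgl3_mk_eq_mk_iff _ _).2 <| tetraRep_swap_conj (ω ^ (Multiplicative.toAdd t).val)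
        (by rw [← pow_mul, mul_comm, pow_mul, hω, one_pow]) i
    simp only [MonoidHom.comp_apply, MulEquiv.coe_toMonoidHom, hs, map_inv, MulAut.conj_apply]
    rw [eq_mul_inv_iff_mul_eq, inv_mul_eq_iff_eq_mul, ← mul_assoc, h]
  | mul σ τ hσ hτ =>
    refine MonoidHom.ext fun t => ?_
    have h1 := DFunLike.congr_fun hσ (signAction τ t)
    have h2 := DFunLike.congr_fun hτ t
    simp only [MonoidHom.comp_apply, MulEquiv.coe_toMonoidHom, MulAut.conj_apply, map_mul,
      MulAut.mul_apply] at h1 h2 ⊢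
    rw [h1, h2]
    group

/-- The embedding of `Z/3Z ⋊ S₄` in `PGL₃(K)`. -/
noncomputable def semidirectProj (ω : K) (hω : ω ^ 3 = 1) :
    Multiplicative (ZMod 3) ⋊[signAction] Equiv.Perm (Fin 4) →* PGL3 K :=
  SemidirectProduct.lift (diagProj ω hω) (tetraProj K) (diagProj_signAction ω hω)

lemma semidirectProj_eq_mk (ω : K) (hω : ω ^ 3 = 1)
    (g : Multiplicative (ZMod 3) ⋊[signAction] Equiv.Perm (Fin 4)) :
    semidirectProj ω hω g = QuotientGroup.mk
      ((diagRep ω hω).toHomUnits g.left * (tetraRep K).toHomUnits g.right) :=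
  rfl

lemma diagRep_mul_tetraRep_mulVec (ω : K) (hω : ω ^ 3 = 1) (t : Multiplicative (ZMod 3))
    (σ : Equiv.Perm (Fin 4)) (j : Fin 4) (r : Fin 3) :
    (diagRep ω hω t * tetraRep K σ).mulVec (tetraVertex K j) r
      = (ω ^ (Multiplicative.toAdd t).val) ^ (r : ℕ) * tetraVertex K (σ j) r := by
  rw [← Matrix.mulVec_mulVec, tetraRep_mulVec]
  simp [diagRep, Matrix.mulVec_diagonal]

lemma semidirectProj_injective {ω : K} (hω : IsPrimitiveRoot ω 3) :
    Function.Injective (semidirectProj ω hω.pow_eq_one) := by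
  rw [injective_iff_map_eq_one]
  rintro ⟨t, σ⟩ h
  rw [semidirectProj_eq_mk, ← QuotientGroup.mk_one, pgl3_mk_eq_mk_iff] at h
  obtain ⟨c, hc⟩ := h
  simp only [Units.val_mul, MonoidHom.coe_toHomUnits, Units.val_one] at hc
  set x := ω ^ (Multiplicative.toAdd t).val with hxdef
  have hx3 : x ^ 3 = 1 := by rw [hxdef, ← pow_mul, mul_comm, pow_mul, hω.pow_eq_one, one_pow]
  have hv : ∀ (j : Fin 4) (r : Fin 3),
      x ^ (r : ℕ) * tetraVertex K (σ j) r = c * tetraVertex K j r := by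
    intro j r
    rw [← diagRep_mul_tetraRep_mulVec ω hω.pow_eq_one t σ j r, hc]
    simp [Matrix.smul_mulVec]
  have hsq : ∀ r, tetraVertex K (σ 0) r ^ 2 = 1 := fun r => by
    rcases tetraVertex_eq_one_or (K := K) (σ 0) r with h | h <;> simp [h]
  have h00 : tetraVertex K (σ 0) 0 = c := by simpa [tetraVertex] using hv 0 0
  have hc2 : c ^ 2 = 1 := h00 ▸ hsq 0
  have h01 : x * tetraVertex K (σ 0) 1 = c := by simpa [tetraVertex] using hv 0 1
  have hx2 : x ^ 2 = 1 := by
    have := congrArg (· ^ 2) h01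
    simpa [mul_pow, hsq, hc2] using this
  have hx : x = 1 := by linear_combination hx3 - x * hx2
  have ht : t = 1 := by
    have h := (hω.pow_eq_one_iff_dvd _).1 (hxdef.symm.trans hx)
    have h0 : (Multiplicative.toAdd t).val = 0 := Nat.eq_zero_of_dvd_of_lt h (ZMod.val_lt _)
    exact (ZMod.val_eq_zero _).1 h0
  simp only [hx, one_pow, one_mul] at hv
  have hc1 : c = 1 := by
    have h := tetraVertex_prod (K := K) (σ 0)
    rw [hv, hv, hv] at h
    simp [tetraVertex] at h
    linear_combination h - c * hc2
  have hσ : σ = 1 := Equiv.ext fun j => tetraVertex_injective (funext fun r => by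
    rw [hv, hc1, one_mul]; rfl)
  rw [ht, hσ]
  rfl

end SemidirectProduct

section AutomorphismGroup

variable [CharZero K]

lemma exists_sign_decomposition {ω c : K} (hω : IsPrimitiveRoot ω 3) {b : Fin 3 → K}
    (hb : ∀ r, b r ≠ 0) (h6 : ∀ r, b r ^ 6 = c) (h2 : (b 0 * b 1 * b 2) ^ 2 = c) :
    ∃ (t : Multiplicative (ZMod 3)) (a : K) (s : Fin 3 → K), (∀ r, s r = 1 ∨ s r = -1) ∧
      s 0 * s 1 * s 2 = 1 ∧
      ∀ r : Fin 3, b r = a * (ω ^ (Multiplicative.toAdd t).val) ^ (r : ℕ) * s r := by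
  have hb0 := hb 0
  set u := b 1 / b 0 with hu
  set w := b 2 / b 0 with hw
  have hb1 : b 1 = b 0 * u := by rw [hu]; field_simp
  have hb2 : b 2 = b 0 * w := by rw [hw]; field_simp
  have hu6 : u ^ 6 = 1 := by
    rw [hu, div_pow, h6, h6, div_self]
    rw [← h6 0]; exact pow_ne_zero _ hb0
  have huw : (u * w) ^ 2 = 1 := by
    apply mul_left_cancel₀ (pow_ne_zero 6 hb0)
    rw [hb1, hb2] at h2
    linear_combination h2 - h6 0
  obtain ⟨k, -, hk⟩ := hω.eq_pow_of_pow_eq_one (ξ := u ^ 2) (by rw [← pow_mul]; exact hu6)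
  set t : Multiplicative (ZMod 3) := Multiplicative.ofAdd ((2 * k : ℕ) : ZMod 3)
  have hx : ω ^ (Multiplicative.toAdd t).val = u ^ 4 := by
    rw [toAdd_ofAdd, ZMod.val_natCast, ← pow_eq_pow_mod _ hω.pow_eq_one, mul_comm, pow_mul, hk,
      ← pow_mul]
  refine ⟨t, b 0 * (u * w), ![u * w, u * w * u ^ 3, u ^ 4 * w * (u * w)], fun r => ?_, ?_,
    fun r => ?_⟩
  · rw [← sq_eq_one_iff]
    obtain rfl | rfl | rfl : r = 0 ∨ r = 1 ∨ r = 2 := by revert r; decide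
    · exact huw
    · change (u * w * u ^ 3) ^ 2 = 1
      linear_combination huw * u ^ 6 + hu6
    · change (u ^ 4 * w * (u * w)) ^ 2 = 1
      linear_combination huw * (u ^ 4 * w) ^ 2 + huw * u ^ 6 + hu6
  · change u * w * (u * w * u ^ 3) * (u ^ 4 * w * (u * w)) = 1
    linear_combination huw * ((u * w) ^ 2 + 1) * u ^ 6 + hu6
  · rw [hx]
    obtain rfl | rfl | rfl : r = 0 ∨ r = 1 ∨ r = 2 := by revert r; decide
    · change b 0 = b 0 * (u * w) * (u ^ 4) ^ 0 * (u * w)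
      linear_combination - b 0 * huw
    · change b 1 = b 0 * (u * w) * (u ^ 4) ^ 1 * (u * w * u ^ 3)
      linear_combination hb1 - b 0 * u * hu6 - b 0 * u ^ 7 * huw
    · change b 2 = b 0 * (u * w) * (u ^ 4) ^ 2 * (u ^ 4 * w * (u * w))
      linear_combination hb2 - b 0 * w * u ^ 12 * huw - b 0 * w * (u ^ 6 + 1) * hu6

lemma planeAut_le_range {ω β : K} (hω : IsPrimitiveRoot ω 3) (hβ : β ≠ 0) :
    planeAut (fermatDescendant β) ≤ (semidirectProj ω hω.pow_eq_one).range := by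
  rintro _ ⟨A, rfl, c, -, hA⟩
  obtain ⟨ρ, b, hb, hAb⟩ := exists_perm_of_matAct hβ A hA
  obtain ⟨h6, h2⟩ := monomial_coefficients hβ A.val hA ρ b hAb
  obtain ⟨t, a, s, hs, hs1, hbs⟩ := exists_sign_decomposition hω hb h6 h2
  have hτ : ∀ j, ∃ k, (fun r => s r * tetraVertex K j (ρ r)) = tetraVertex K k := by
    intro j
    refine exists_tetraVertex_eq _ (fun r => ?_) ?_
    · rcases hs r with h | h <;> rcases tetraVertex_eq_one_or (K := K) j (ρ r) with h' | h' <;>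
        simp [h, h']
    · have hp := Equiv.prod_comp ρ (tetraVertex K j)
      simp only [Fin.prod_univ_three, tetraVertex_prod] at hp
      linear_combination hs1 * (tetraVertex K j (ρ 0) * tetraVertex K j (ρ 1)
        * tetraVertex K j (ρ 2)) + hp
  choose τ hτ using hτ
  have hAv : ∀ j (r : Fin 3), A.val.mulVec (tetraVertex K j) r
      = a * ((ω ^ (Multiplicative.toAdd t).val) ^ (r : ℕ) * tetraVertex K (τ j) r) := by
    intro j r
    rw [hAb, hbs, ← hτ]
    ring
  have hinj : Function.Injective τ := by
    intro i j hij
    refine tetraVertex_injective (K := K) (Matrix.mulVec_injective_of_isUnit A.isUnit ?_)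
    funext r
    rw [hAv, hAv, hij]
  set σ : Equiv.Perm (Fin 4) := Equiv.ofBijective τ (Finite.injective_iff_bijective.1 hinj)
  refine ⟨⟨t, σ⟩, ?_⟩
  rw [semidirectProj_eq_mk, eq_comm, pgl3_mk_eq_mk_iff]
  refine ⟨a, matrix_ext_of_tetraVertex fun j => funext fun r => ?_⟩
  rw [hAv, Units.val_mul, MonoidHom.coe_toHomUnits, MonoidHom.coe_toHomUnits, Matrix.smul_mulVec,
    Pi.smul_apply, diagRep_mul_tetraRep_mulVec, smul_eq_mul]
  rfl

lemma pgl_mem_planeAut {M : Matrix (Fin 3) (Fin 3) K} {F : MvPolynomial (Fin 3) K}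
    (hM : M.det ≠ 0) (h : matAct M F = F) : pgl M ∈ planeAut F := by
  have hu : IsUnit M := (Matrix.isUnit_iff_isUnit_det M).2 (isUnit_iff_ne_zero.2 hM)
  refine ⟨hu.unit, ?_, 1, one_ne_zero, ?_⟩
  · rw [pgl, dif_pos hu]
  · rw [IsUnit.unit_spec, h, one_smul]

/-- The subgroup generated by `diag(1, ζ, ζ²)`, `diag(1, 1, −1)`, `[Z:Y:X]` and `[Y:Z:X]`. -/
noncomputable abbrev generatedSubgroup (ζ : K) : Subgroup (PGL3 K) :=
  Subgroup.closure
    {pgl !![1, 0, 0; 0, ζ, 0; 0, 0, ζ ^ 2], pgl !![(1 : K), 0, 0; 0, 1, 0; 0, 0, -1],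
      pgl !![(0 : K), 0, 1; 0, 1, 0; 1, 0, 0], pgl !![(0 : K), 1, 0; 0, 0, 1; 1, 0, 0]}

lemma generatedSubgroup_le_planeAut {ζ : K} (hζ : ζ ^ 6 = 1) (β : K) :
    generatedSubgroup ζ ≤ planeAut (fermatDescendant β) := by
  have hζ0 : ζ ≠ 0 := by rintro rfl; simp at hζ
  have hC : (C ζ : MvPolynomial (Fin 3) K) ^ 6 = 1 := by rw [← C_pow, hζ, C_1]
  rw [generatedSubgroup, Subgroup.closure_le]
  rintro _ (rfl | rfl | rfl | rfl)
  · refine pgl_mem_planeAut (by simp [Matrix.det_fin_three, hζ0]) ?_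
    simp [matAct, Fin.sum_univ_three]
    linear_combination (X 1 ^ 6 + X 2 ^ 6 * (C ζ ^ 6 + 1)
      + C β * X 0 ^ 2 * X 1 ^ 2 * X 2 ^ 2) * hC
  · refine pgl_mem_planeAut (by simp [Matrix.det_fin_three]) ?_
    simp [matAct, Fin.sum_univ_three]
    ring
  · refine pgl_mem_planeAut (by simp [Matrix.det_fin_three]) ?_
    simp [matAct, Fin.sum_univ_three]
    ring
  · refine pgl_mem_planeAut (by simp [Matrix.det_fin_three]) ?_
    simp [matAct, Fin.sum_univ_three]
    ring

lemma tetraProj_mem_generatedSubgroup (ζ : K) (σ : Equiv.Perm (Fin 4)) :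
    tetraProj K σ ∈ generatedSubgroup ζ := by
  have hmem : ∀ {M : Matrix (Fin 3) (Fin 3) K} {σ : Equiv.Perm (Fin 4)} {c : K}, c ≠ 0 →
      M = c • tetraRep K σ → pgl M ∈ generatedSubgroup ζ → tetraProj K σ ∈ generatedSubgroup ζ :=
    fun hc h hM => by rwa [pgl_eq_mk (A := (tetraRep K).toHomUnits _) hc h] at hM
  have ha : tetraProj K (Equiv.swap 1 3) ∈ generatedSubgroup ζ := by
    refine hmem one_ne_zero ?_ (Subgroup.subset_closure (.inr (.inr (.inl rfl))))
    rw [one_smul, tetraRep_eq]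
    intro j
    ext r; fin_cases j <;> fin_cases r <;> simp [tetraVertex, Equiv.swap_apply_def]
  have hb : tetraProj K (Equiv.swap 1 2 * Equiv.swap 1 3) ∈ generatedSubgroup ζ := by
    refine hmem one_ne_zero ?_ (Subgroup.subset_closure (.inr (.inr (.inr rfl))))
    rw [one_smul, tetraRep_eq]
    intro j
    ext r; fin_cases j <;> fin_cases r <;> simp [tetraVertex, Equiv.swap_apply_def]
  have hd : tetraProj K (Equiv.swap 0 3 * Equiv.swap 1 2) ∈ generatedSubgroup ζ := by
    refine hmem (c := -1) (by simp) ?_ (Subgroup.subset_closure (.inr (.inl rfl)))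
    rw [tetraRep_eq (M := !![-1, 0, 0; 0, -1, 0; 0, 0, 1])]
    · simp
    · intro j
      ext r; fin_cases j <;> fin_cases r <;> simp [tetraVertex, Equiv.swap_apply_def]
  set b : Equiv.Perm (Fin 4) := Equiv.swap 1 2 * Equiv.swap 1 3 with hbdef
  have h23 : tetraProj K (Equiv.swap 2 3) ∈ generatedSubgroup ζ := by
    have h : (Equiv.swap 2 3 : Equiv.Perm (Fin 4)) = b * Equiv.swap 1 3 * b⁻¹ := by
      rw [hbdef]; decide
    rw [h, map_mul, map_mul, map_inv]
    exact mul_mem (mul_mem hb ha) (inv_mem hb)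
  induction σ using perm_fin_four_induction with
  | one => rw [map_one]; exact one_mem _
  | swap i =>
    obtain rfl | rfl | rfl : i = 0 ∨ i = 1 ∨ i = 2 := by revert i; decide
    · have h : (Equiv.swap (Fin.castSucc 0) (Fin.succ 0) : Equiv.Perm (Fin 4))
          = (Equiv.swap 0 3 * Equiv.swap 1 2) * Equiv.swap 2 3
            * (Equiv.swap 0 3 * Equiv.swap 1 2) := by decide
      rw [h, map_mul, map_mul]
      exact mul_mem (mul_mem hd h23) hd
    · have h : (Equiv.swap (Fin.castSucc 1) (Fin.succ 1) : Equiv.Perm (Fin 4))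
          = b⁻¹ * Equiv.swap 1 3 * b := by rw [hbdef]; decide
      rw [h, map_mul, map_mul, map_inv]
      exact mul_mem (mul_mem (inv_mem hb) ha) hb
    · exact h23
  | mul σ τ hσ hτ => rw [map_mul]; exact mul_mem hσ hτ

lemma diagProj_mem_generatedSubgroup {ζ : K} (hζ : (ζ ^ 2) ^ 3 = 1)
    (t : Multiplicative (ZMod 3)) : diagProj (ζ ^ 2) hζ t ∈ generatedSubgroup ζ := by
  have hM : (!![1, 0, 0; 0, ζ, 0; 0, 0, ζ ^ 2] : Matrix (Fin 3) (Fin 3) K)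
      = Matrix.diagonal fun r : Fin 3 => ζ ^ (r : ℕ) := by
    ext i j
    fin_cases i <;> fin_cases j <;> simp
  have hζ0 : ζ ≠ 0 := by rintro rfl; simp at hζ
  have hu : IsUnit (!![1, 0, 0; 0, ζ, 0; 0, 0, ζ ^ 2] : Matrix (Fin 3) (Fin 3) K) :=
    (Matrix.isUnit_iff_isUnit_det _).2 (isUnit_iff_ne_zero.2 (by
      simp [Matrix.det_fin_three, hζ0]))
  have hg : (QuotientGroup.mk hu.unit : PGL3 K) ∈ generatedSubgroup ζ := by
    rw [← pgl_eq_mk one_ne_zero ((one_smul K _).trans hu.unit_spec).symm]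
    exact Subgroup.subset_closure (.inl rfl)
  have h : diagProj (ζ ^ 2) hζ t
      = (QuotientGroup.mk hu.unit : PGL3 K) ^ (2 * (Multiplicative.toAdd t).val) := by
    rw [← QuotientGroup.mk_pow]
    refine congrArg QuotientGroup.mk (Units.ext ?_)
    rw [Units.val_pow_eq_pow_val, IsUnit.unit_spec, hM, Matrix.diagonal_pow]
    refine congrArg Matrix.diagonal (funext fun r => ?_)
    simp only [Pi.pow_apply, ← pow_mul]
    ring
  rw [h]
  exact pow_mem hg _

lemma range_semidirectProj_le {ζ : K} (hζ : (ζ ^ 2) ^ 3 = 1) :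
    (semidirectProj (ζ ^ 2) hζ).range ≤ generatedSubgroup ζ := by
  rintro _ ⟨g, rfl⟩
  exact mul_mem (diagProj_mem_generatedSubgroup hζ g.left)
    (tetraProj_mem_generatedSubgroup ζ g.right)

end AutomorphismGroup

/-- For `β ≠ 0` with `X⁶ + Y⁶ + Z⁶ + βX²Y²Z²` smooth, the automorphism group is
generated by `diag(1, ζ₆, ζ₆²)`, `diag(1, 1, −1)`, `[Z:Y:X]` and `[Y:Z:X]`, has order `72`,
and is isomorphic to a semidirect product `Z/3Z ⋊ S₄`. -/
theorem centralFermatDescendant_sextic_automorphisms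
    {K : Type*} [Field K] [IsAlgClosed K] [CharZero K]
    (ζ : K) (hζ : IsPrimitiveRoot ζ 6) (β : K) (hβ : β ≠ 0)
    (hsm : IsSmoothSextic (X 0 ^ 6 + X 1 ^ 6 + X 2 ^ 6
      + C β * X 0 ^ 2 * X 1 ^ 2 * X 2 ^ 2 : MvPolynomial (Fin 3) K)) :
    planeAut (X 0 ^ 6 + X 1 ^ 6 + X 2 ^ 6
        + C β * X 0 ^ 2 * X 1 ^ 2 * X 2 ^ 2 : MvPolynomial (Fin 3) K)
      = Subgroup.closure
        {pgl !![1, 0, 0; 0, ζ, 0; 0, 0, ζ ^ 2], pgl !![(1 : K), 0, 0; 0, 1, 0; 0, 0, -1],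
          pgl !![(0 : K), 0, 1; 0, 1, 0; 1, 0, 0], pgl !![(0 : K), 1, 0; 0, 0, 1; 1, 0, 0]} ∧
    Nat.card ↥(planeAut (X 0 ^ 6 + X 1 ^ 6 + X 2 ^ 6
      + C β * X 0 ^ 2 * X 1 ^ 2 * X 2 ^ 2 : MvPolynomial (Fin 3) K)) = 72 ∧
    (∃ φ : Equiv.Perm (Fin 4) →* MulAut (Multiplicative (ZMod 3)),
      Nonempty (↥(planeAut (X 0 ^ 6 + X 1 ^ 6 + X 2 ^ 6
          + C β * X 0 ^ 2 * X 1 ^ 2 * X 2 ^ 2 : MvPolynomial (Fin 3) K))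
        ≃* Multiplicative (ZMod 3) ⋊[φ] Equiv.Perm (Fin 4))) := by
  have hω : IsPrimitiveRoot (ζ ^ 2) 3 := hζ.pow (by norm_num) (by norm_num)
  have h1 := generatedSubgroup_le_planeAut hζ.pow_eq_one β
  have h2 := planeAut_le_range hω hβ
  have h3 := range_semidirectProj_le hω.pow_eq_one
  have hrange : planeAut (fermatDescendant β) = (semidirectProj (ζ ^ 2) hω.pow_eq_one).range :=
    le_antisymm h2 (h3.trans h1)
  let e : Multiplicative (ZMod 3) ⋊[signAction] Equiv.Perm (Fin 4)
      ≃* planeAut (fermatDescendant β) :=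
    (MonoidHom.ofInjective (semidirectProj_injective hω)).trans (MulEquiv.subgroupCongr hrange.symm)
  refine ⟨le_antisymm (h2.trans h3) h1, ?_, signAction, ⟨e.symm⟩⟩
  rw [← Nat.card_congr e.toEquiv, SemidirectProduct.card, Nat.card_eq_fintype_card,
    Nat.card_eq_fintype_card, Fintype.card_multiplicative, ZMod.card, Fintype.card_perm,
    Fintype.card_fin]
  rfl
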